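/- Let B : ℝ → ℝ be continuously differentiable with B(ξ) ≥ 0 for all ξ, and let w : ℝ × [0,T] → ℝ be a smooth function, 1-periodic in x, satisfying ∂_t w = B(w) ∂_x² w on ℝ × [0,T]. Then for all 0 ≤ t₁ ≤ t₂ ≤ T, both max_{x ∈ [0,1]} |w(x,t₂)| ≤ max_{x ∈ [0,1]} |w(x,t₁)| and max_{x ∈ [0,1]} |∂_x w(x,t₂)| ≤ max_{x ∈ [0,1]} |∂_x w(x,t₁)|. -/

import Mathlib

set_option autoImplicit false

/-- Second derivative test, necessary condition at a maximum. -/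
lemma IsLocalMax.second_deriv_nonpos {f f' : ℝ → ℝ} {c x : ℝ} (hmax : IsLocalMax f x)
    (hf : ∀ y, HasDerivAt f (f' y) y) (hf' : HasDerivAt f' c x) : c ≤ 0 := by
  by_contra! hc
  have hd : deriv f = f' := funext fun y => (hf y).deriv
  have hmin : IsLocalMin f x := by
    refine isLocalMin_of_deriv_deriv_pos ?_ ?_ (hf x).continuousAt
    · rwa [hd, hf'.deriv]
    · exact hmax.deriv_eq_zero
  have hconst : f =ᶠ[nhds x] fun _ => f x := by
    filter_upwards [hmax, hmin] with y h₁ h₂ using le_antisymm h₁ h₂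
  have hzero : f' =ᶠ[nhds x] fun _ => 0 := by
    filter_upwards [hconst.eventuallyEq_nhds] with y hy
    rw [← (hf y).deriv, hy.deriv_eq, deriv_const]
  have := hzero.deriv_eq
  rw [hf'.deriv, deriv_const] at this
  exact hc.ne' this

/-- A left-sided maximum forces a nonnegative derivative. -/
lemma HasDerivAt.nonneg_of_forall_le_left {f : ℝ → ℝ} {c a b : ℝ} (hab : a < b)
    (hf : HasDerivAt f c b) (hmax : ∀ s ∈ Set.Icc a b, f s ≤ f b) : 0 ≤ c := by
  have h := hasDerivAt_iff_tendsto_slope_left_right.1 hf |>.1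
  refine ge_of_tendsto h ?_
  filter_upwards [Ioo_mem_nhdsLT hab] with s hs
  rw [slope_def_field]
  exact div_nonneg_of_nonpos (sub_nonpos.2 (hmax s ⟨hs.1.le, hs.2.le⟩)) (sub_nonpos.2 hs.2.le)

/-- Weak maximum principle for periodic solutions of degenerate parabolic equations. -/
lemma le_of_periodic_parabolic {u ux uxx ut : ℝ → ℝ → ℝ} {t₁ t₂ M : ℝ} (h12 : t₁ ≤ t₂)
    (hc : Continuous fun p : ℝ × ℝ => u p.1 p.2)
    (hper : ∀ t, Function.Periodic (fun x => u x t) 1)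
    (hx : ∀ x t, HasDerivAt (fun y => u y t) (ux x t) x)
    (hxx : ∀ x t, HasDerivAt (fun y => ux y t) (uxx x t) x)
    (ht : ∀ x t, HasDerivAt (fun s => u x s) (ut x t) t)
    (hpar : ∀ x, ∀ t ∈ Set.Icc t₁ t₂, ux x t = 0 → uxx x t ≤ 0 → ut x t ≤ 0)
    (hM : ∀ x, u x t₁ ≤ M) (x : ℝ) : u x t₂ ≤ M := by
  have key : ∀ ε > 0, u x t₂ ≤ M + ε * (t₂ - t₁) := by
    intro ε hε
    obtain ⟨⟨x₀, t₀⟩, ⟨hx₀, ht₀⟩, hmax⟩ :=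
      (isCompact_Icc.prod isCompact_Icc : IsCompact (Set.Icc (0 : ℝ) 1 ×ˢ Set.Icc t₁ t₂)).exists_isMaxOn
        ⟨(0, t₁), by simp [h12]⟩
        (f := fun p : ℝ × ℝ => u p.1 p.2 - ε * (p.2 - t₁)) (by fun_prop)
    have hglob : ∀ y, ∀ s ∈ Set.Icc t₁ t₂,
        u y s - ε * (s - t₁) ≤ u x₀ t₀ - ε * (t₀ - t₁) := by
      intro y s hs
      obtain ⟨y', hy', he⟩ := (hper s).exists_mem_Ico₀ one_pos y
      have := hmax (Set.mk_mem_prod (Set.Ico_subset_Icc_self hy') hs)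
      change u y s = u y' s at he
      rw [he]
      exact this
    have ht₀' : t₀ = t₁ := by
      by_contra hne
      have hlt : t₁ < t₀ := lt_of_le_of_ne ht₀.1 (Ne.symm hne)
      have hloc : IsLocalMax (fun y => u y t₀) x₀ :=
        Filter.Eventually.of_forall fun y => by simpa using hglob y t₀ ht₀
      have h₁ := hpar x₀ t₀ ht₀ (hloc.hasDerivAt_eq_zero (hx x₀ t₀))
        (hloc.second_deriv_nonpos (fun y => hx y t₀) (hxx x₀ t₀))
      have h₂ : 0 ≤ ut x₀ t₀ - ε * 1 :=
        ((ht x₀ t₀).sub (((hasDerivAt_id t₀).sub_const t₁).const_mul ε)).nonneg_of_forall_le_left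
          hlt fun s hs => hglob x₀ s ⟨hs.1, hs.2.trans ht₀.2⟩
      linarith
    have h := hglob x t₂ ⟨h12, le_rfl⟩
    rw [ht₀'] at h
    linarith [hM x₀]
  have hlim : Filter.Tendsto (fun ε : ℝ => M + ε * (t₂ - t₁)) (nhdsWithin 0 (Set.Ioi 0))
      (nhds M) := by
    have : Continuous fun ε : ℝ => M + ε * (t₂ - t₁) := by fun_prop
    simpa using (this.tendsto 0).mono_left nhdsWithin_le_nhds
  exact ge_of_tendsto hlim (by filter_upwards [self_mem_nhdsWithin] with ε hε using key ε hε)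

lemma iSup_abs_le_of_periodic_parabolic {u ux uxx ut a b : ℝ → ℝ → ℝ} {t₁ t₂ : ℝ} (h12 : t₁ ≤ t₂)
    (hc : Continuous fun p : ℝ × ℝ => u p.1 p.2)
    (hper : ∀ t, Function.Periodic (fun x => u x t) 1)
    (hx : ∀ x t, HasDerivAt (fun y => u y t) (ux x t) x)
    (hxx : ∀ x t, HasDerivAt (fun y => ux y t) (uxx x t) x)
    (ht : ∀ x t, HasDerivAt (fun s => u x s) (ut x t) t)
    (ha : ∀ x t, 0 ≤ a x t)
    (heq : ∀ x, ∀ t ∈ Set.Icc t₁ t₂, ut x t = a x t * uxx x t + b x t * ux x t) :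
    (⨆ x : Set.Icc (0 : ℝ) 1, |u (x : ℝ) t₂|) ≤ ⨆ x : Set.Icc (0 : ℝ) 1, |u (x : ℝ) t₁| := by
  have hbdd : BddAbove (Set.range fun x : Set.Icc (0 : ℝ) 1 => |u (x : ℝ) t₁|) := by
    have hcont : Continuous fun x : Set.Icc (0 : ℝ) 1 => |u (x : ℝ) t₁| :=
      (hc.comp (continuous_subtype_val.prodMk continuous_const)).abs
    exact (isCompact_range hcont).bddAbove
  have hM : ∀ x, |u x t₁| ≤ ⨆ x : Set.Icc (0 : ℝ) 1, |u (x : ℝ) t₁| := by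
    intro x
    obtain ⟨y, hy, he⟩ := (hper t₁).exists_mem_Ico₀ one_pos x
    change u x t₁ = u y t₁ at he
    rw [he]
    exact le_ciSup hbdd ⟨y, Set.Ico_subset_Icc_self hy⟩
  have : Nonempty (Set.Icc (0 : ℝ) 1) := ⟨⟨0, by simp⟩⟩
  refine ciSup_le fun x => abs_le'.2 ⟨?_, ?_⟩
  · refine le_of_periodic_parabolic h12 hc hper hx hxx ht (fun x t hmem h₁ h₂ => ?_)
      (fun x => (abs_le'.1 (hM x)).1) x
    rw [heq x t hmem, h₁, mul_zero, add_zero]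
    exact mul_nonpos_of_nonneg_of_nonpos (ha x t) h₂
  · refine le_of_periodic_parabolic (u := fun x t => -u x t) (ux := fun x t => -ux x t)
      (uxx := fun x t => -uxx x t) (ut := fun x t => -ut x t) h12 hc.neg
      (fun t x => congrArg Neg.neg (hper t x)) (fun x t => (hx x t).neg) (fun x t => (hxx x t).neg)
      (fun x t => (ht x t).neg) (fun x t hmem h₁ h₂ => ?_) (fun x => (abs_le'.1 (hM x)).2) x
    rw [heq x t hmem, neg_eq_zero.1 h₁, mul_zero, add_zero]
    exact neg_nonpos.2 (mul_nonneg (ha x t) (neg_nonpos.1 h₂))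

lemma DifferentiableAt.hasDerivAt_prod_fst {f : ℝ × ℝ → ℝ} {x t : ℝ}
    (hf : DifferentiableAt ℝ f (x, t)) :
    HasDerivAt (fun y => f (y, t)) (fderiv ℝ f (x, t) (1, 0)) x :=
  hf.hasFDerivAt.comp_hasDerivAt x ((hasDerivAt_id x).prodMk (hasDerivAt_const x t))

lemma DifferentiableAt.hasDerivAt_prod_snd {f : ℝ × ℝ → ℝ} {x t : ℝ}
    (hf : DifferentiableAt ℝ f (x, t)) :
    HasDerivAt (fun s => f (x, s)) (fderiv ℝ f (x, t) (0, 1)) t :=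
  hf.hasFDerivAt.comp_hasDerivAt t ((hasDerivAt_const t x).prodMk (hasDerivAt_id t))

lemma ContDiff.fderiv_apply_const_top {f : ℝ × ℝ → ℝ} (hf : ContDiff ℝ (⊤ : ℕ∞) f) (v : ℝ × ℝ) :
    ContDiff ℝ (⊤ : ℕ∞) (fun p => fderiv ℝ f p v) :=
  (hf.fderiv_right (by simp)).clm_apply contDiff_const

lemma ContDiff.fderiv_fderiv_apply_comm {f : ℝ × ℝ → ℝ} (hf : ContDiff ℝ (⊤ : ℕ∞) f)
    (p v v' : ℝ × ℝ) :
    fderiv ℝ (fun q => fderiv ℝ f q v) p v' = fderiv ℝ (fun q => fderiv ℝ f q v') p v := by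
  have hd : DifferentiableAt ℝ (fderiv ℝ f) p :=
    (hf.fderiv_right (m := (⊤ : ℕ∞)) (by simp)).differentiable (by simp) p
  have hs : IsSymmSndFDerivAt ℝ f p := hf.contDiffAt.isSymmSndFDerivAt
    (by simpa using WithTop.coe_le_coe.2 (le_top : (2 : ℕ∞) ≤ ⊤))
  rw [fderiv_clm_apply hd (differentiableAt_const _), fderiv_clm_apply hd (differentiableAt_const _)]
  simpa using hs v' v

/-- **Maximum principles for `w` and `∂ₓw`.**
If `w` is a smooth, 1-periodic-in-`x` solution of `w_t = B(w) w_xx` on `ℝ × [0,T]`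
with `B ≥ 0` continuously differentiable, then both `max_{x∈[0,1]} |w(x,t)|` and
`max_{x∈[0,1]} |∂ₓw(x,t)|` are nonincreasing in `t` on `[0,T]`. -/
theorem max_principles_w_and_wx (T : ℝ) (hT : 0 < T)
    (B : ℝ → ℝ) (hBreg : ContDiff ℝ 1 B) (hB0 : ∀ ξ : ℝ, 0 ≤ B ξ)
    (w : ℝ → ℝ → ℝ) (hw : ContDiff ℝ (⊤ : ℕ∞) (fun p : ℝ × ℝ => w p.1 p.2))
    (hper : ∀ x t : ℝ, w (x + 1) t = w x t)
    (heq : ∀ x : ℝ, ∀ t ∈ Set.Icc (0 : ℝ) T,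
      deriv (fun s => w x s) t = B (w x t) * iteratedDeriv 2 (fun y => w y t) x) :
    ∀ t₁ ∈ Set.Icc (0 : ℝ) T, ∀ t₂ ∈ Set.Icc (0 : ℝ) T, t₁ ≤ t₂ →
      (⨆ x : Set.Icc (0 : ℝ) 1, |w (x : ℝ) t₂|)
        ≤ (⨆ x : Set.Icc (0 : ℝ) 1, |w (x : ℝ) t₁|) ∧
      (⨆ x : Set.Icc (0 : ℝ) 1, |deriv (fun y => w y t₂) (x : ℝ)|)
        ≤ (⨆ x : Set.Icc (0 : ℝ) 1, |deriv (fun y => w y t₁) (x : ℝ)|) := by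
  intro t₁ ht₁ t₂ ht₂ h12
  have hsub : Set.Icc t₁ t₂ ⊆ Set.Icc 0 T := Set.Icc_subset_Icc ht₁.1 ht₂.2
  set F : ℝ × ℝ → ℝ := fun p => w p.1 p.2 with hF
  set Fx : ℝ × ℝ → ℝ := fun p => fderiv ℝ F p (1, 0) with hFx
  set Ft : ℝ × ℝ → ℝ := fun p => fderiv ℝ F p (0, 1) with hFt
  set Fxx : ℝ × ℝ → ℝ := fun p => fderiv ℝ Fx p (1, 0) with hFxx
  have hFxs : ContDiff ℝ (⊤ : ℕ∞) Fx := hw.fderiv_apply_const_top _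
  have hFts : ContDiff ℝ (⊤ : ℕ∞) Ft := hw.fderiv_apply_const_top _
  have hFxxs : ContDiff ℝ (⊤ : ℕ∞) Fxx := hFxs.fderiv_apply_const_top _
  have dw : Differentiable ℝ F := hw.differentiable (by simp)
  have dx : Differentiable ℝ Fx := hFxs.differentiable (by simp)
  have dt : Differentiable ℝ Ft := hFts.differentiable (by simp)
  have dxx : Differentiable ℝ Fxx := hFxxs.differentiable (by simp)
  have hwx : ∀ x t, HasDerivAt (fun y => w y t) (Fx (x, t)) x :=
    fun x t => (dw (x, t)).hasDerivAt_prod_fst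
  have hwt : ∀ x t, HasDerivAt (fun s => w x s) (Ft (x, t)) t :=
    fun x t => (dw (x, t)).hasDerivAt_prod_snd
  have hwxx : ∀ x t, HasDerivAt (fun y => Fx (y, t)) (Fxx (x, t)) x :=
    fun x t => (dx (x, t)).hasDerivAt_prod_fst
  have hderiv : ∀ t, deriv (fun y => w y t) = fun x => Fx (x, t) :=
    fun t => funext fun x => (hwx x t).deriv
  have hpde : ∀ x, ∀ t ∈ Set.Icc 0 T, Ft (x, t) = B (w x t) * Fxx (x, t) := by
    intro x t ht
    rw [← (hwt x t).deriv, heq x t ht, iteratedDeriv_succ, iteratedDeriv_one, hderiv,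
      (hwxx x t).deriv]
  refine ⟨?_, ?_⟩
  · refine iSup_abs_le_of_periodic_parabolic (b := fun _ _ => 0) h12 hw.continuous
      (fun t x => hper x t) hwx hwxx hwt (fun x t => hB0 (w x t)) fun x t ht => ?_
    rw [hpde x t (hsub ht), zero_mul, add_zero]
  · simp only [hderiv]
    refine iSup_abs_le_of_periodic_parabolic (u := fun x t => Fx (x, t))
      (b := fun x t => deriv B (w x t) * Fx (x, t)) h12 hFxs.continuous ?_ hwxx
      (fun x t => (dxx (x, t)).hasDerivAt_prod_fst) (fun x t => (dx (x, t)).hasDerivAt_prod_snd)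
      (fun x t => hB0 (w x t)) fun x t ht => ?_
    · intro t x
      have h := (hwx (x + 1) t).comp_add_const x 1
      simp only [hper] at h
      exact h.unique (hwx x t)
    · have hB : HasDerivAt B (deriv B (w x t)) (w x t) :=
        (hBreg.differentiable one_ne_zero _).hasDerivAt
      have hrhs := (hB.comp x (hwx x t)).mul (dxx (x, t)).hasDerivAt_prod_fst
      have hlhs := (dt (x, t)).hasDerivAt_prod_fst
      have hfun : (fun y => Ft (y, t)) = fun y => B (w y t) * Fxx (y, t) :=
        funext fun y => hpde y t (hsub ht)
      rw [hfun] at hlhs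
      have hE := hlhs.unique hrhs
      have hcomm : fderiv ℝ Fx (x, t) (0, 1) = fderiv ℝ Ft (x, t) (1, 0) :=
        hw.fderiv_fderiv_apply_comm _ _ _
      rw [hcomm, hE]
      simp only [Function.comp_apply]
      ring
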